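/- Let q : ℝ_x × ℝ_ξ → ℂ be a complex-valued elliptic quadratic form in dimension 1. Then there exists a linear symplectic transformation χ of ℝ² (i.e. a linear map ℝ² → ℝ² with determinant 1) such that the quadratic form q ∘ χ is equal to one of the following normal forms: (i) (x, ξ) ↦ α(ξ² + e^{iθ}x²) with α ∈ ℂ, α ≠ 0, and 0 ≤ θ < π; (ii) (x, ξ) ↦ α(ξ + ix)(ξ + ηx) with α ∈ ℂ, α ≠ 0, η ∈ ℂ, Im η > 0; (iii) (x, ξ) ↦ α(ξ − ix)(ξ + ηx) with α ∈ ℂ, α ≠ 0, η ∈ ℂ, Im η < 0. Moreover, in the cases (ii) and (iii), the numerical range satisfies Σ(q) = ℂ. -/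

import Mathlib

/-- A map `q : E → ℂ` is a complex-valued quadratic form if it is given by a
real-bilinear map evaluated on the diagonal. -/
def IsCQuadForm {E : Type*} [AddCommGroup E] [Module ℝ E] (q : E → ℂ) : Prop :=
  ∃ B : E →ₗ[ℝ] E →ₗ[ℝ] ℂ, ∀ X, q X = B X X

/-- An elliptic complex quadratic form on `ℝ²` is a product of two complex linear forms,
neither of which is proportional to a real one. -/
lemma IsCQuadForm.exists_eq_mul {q : ℝ × ℝ → ℂ} (hq : IsCQuadForm q)
    (hell : ∀ X : ℝ × ℝ, q X = 0 → X = 0) :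
    ∃ a l m : ℂ, a ≠ 0 ∧ l.im ≠ 0 ∧ m.im ≠ 0 ∧
      ∀ x ξ : ℝ, q (x, ξ) = a * ((ξ : ℂ) + l * x) * ((ξ : ℂ) + m * x) := by
  obtain ⟨B, hB⟩ := hq
  obtain ⟨a, ha⟩ : ∃ a, a = B (0, 1) (0, 1) := ⟨_, rfl⟩
  obtain ⟨b, hb⟩ : ∃ b, b = B (0, 1) (1, 0) + B (1, 0) (0, 1) := ⟨_, rfl⟩
  obtain ⟨c, hc⟩ : ∃ c, c = B (1, 0) (1, 0) := ⟨_, rfl⟩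
  have hexp : ∀ x ξ : ℝ, q (x, ξ) = a * ξ ^ 2 + b * x * ξ + c * x ^ 2 := by
    intro x ξ
    have h : ((x, ξ) : ℝ × ℝ) = x • (1, 0) + ξ • (0, 1) := by simp
    rw [hB, h]
    simp only [map_add, map_smul, LinearMap.add_apply, LinearMap.smul_apply, Complex.real_smul,
      smul_add, ha, hb, hc]
    ring
  have ha0 : a ≠ 0 := by
    intro h
    have := hell (0, 1) (by rw [hexp]; simp [h])
    simp at this
  obtain ⟨s, hs⟩ := IsAlgClosed.exists_pow_nat_eq (discrim a b c) (n := 2) (by norm_num)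
  obtain ⟨r, hr⟩ := exists_quadratic_eq_zero ha0 ⟨s, by rw [← hs, sq]⟩
  have hfac : ∀ x ξ : ℝ,
      q (x, ξ) = a * ((ξ : ℂ) + (-r) * x) * ((ξ : ℂ) + (b / a + r) * x) := by
    intro x ξ
    rw [hexp]
    field_simp
    linear_combination (x : ℂ) ^ 2 * hr
  have him : ∀ l : ℂ, (∀ x ξ : ℝ, (ξ : ℂ) + l * x = 0 → q (x, ξ) = 0) → l.im ≠ 0 := by
    intro l hl h
    have hre : l = (l.re : ℂ) := Complex.ext (by simp) (by simp [h])
    have := hell (1, -l.re) (hl _ _ (by rw [hre]; simp))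
    simp at this
  refine ⟨a, -r, b / a + r, ha0, him _ ?_, him _ ?_, hfac⟩ <;>
  · intro x ξ h
    rw [hfac, h]
    simp

lemma exists_linearMap_det_eq_one {a b c d : ℝ} (h : a * d - b * c = 1) :
    ∃ χ : (ℝ × ℝ) →ₗ[ℝ] (ℝ × ℝ), LinearMap.det χ = 1 ∧
      ∀ x ξ : ℝ, χ (x, ξ) = (a * x + b * ξ, c * x + d * ξ) := by
  refine ⟨Matrix.toLin (Module.Basis.finTwoProd ℝ) (Module.Basis.finTwoProd ℝ) !![a, b; c, d],
    ?_, ?_⟩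
  · rw [LinearMap.det_toLin, Matrix.det_fin_two_of, h]
  · intro x ξ
    rw [Matrix.toLin_finTwoProd_apply]

/-- A symplectic map brings the first factor to the form `ξ + εix` when the imaginary part of its
coefficient is `εκ²`. -/
lemma exists_linearMap_normalize_factor (l m : ℂ) {ε κ : ℝ} (hκ : 0 < κ)
    (hl : l.im = ε * κ ^ 2) :
    ∃ χ : (ℝ × ℝ) →ₗ[ℝ] (ℝ × ℝ), LinearMap.det χ = 1 ∧
      ∃ η : ℂ, η.im = m.im / κ ^ 2 ∧ ∀ x ξ : ℝ,
        (((χ (x, ξ)).2 : ℂ) + l * (χ (x, ξ)).1) * ((χ (x, ξ)).2 + m * (χ (x, ξ)).1) =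
          (κ : ℂ) ^ 2 * ((ξ : ℂ) + ε * Complex.I * x) * ((ξ : ℂ) + η * x) := by
  obtain ⟨χ, hdet, hχ⟩ := exists_linearMap_det_eq_one
    (a := κ⁻¹) (b := 0) (c := -(l.re / κ)) (d := κ) (by field_simp; simp)
  refine ⟨χ, hdet, (m - l.re) / (κ ^ 2 : ℝ), by rw [Complex.div_ofReal_im]; simp, ?_⟩
  intro x ξ
  have hκ' : (κ : ℂ) ≠ 0 := by exact_mod_cast hκ.ne'
  have hl' : l = l.re + ε * κ ^ 2 * Complex.I :=
    Complex.ext (by simp [← Complex.ofReal_pow]) (by simp [← Complex.ofReal_pow, hl])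
  obtain ⟨p, hp⟩ : ∃ p, p = l.re := ⟨_, rfl⟩
  rw [← hp] at hl' hχ ⊢
  rw [hχ, hl']
  push_cast
  field_simp
  ring

lemma exists_mul_sq_add_mul_norm_sq {A B : ℂ} (h : ‖B‖ < ‖A‖) (w : ℂ) :
    ∃ z : ℂ, A * z ^ 2 + B * (‖z‖ : ℂ) ^ 2 = w := by
  have hA : A ≠ 0 := norm_pos_iff.mp ((norm_nonneg B).trans_lt h)
  have hd : 0 < ‖A‖ - ‖B‖ := sub_pos.mpr h
  obtain ⟨R, hR⟩ : ∃ R, R = ‖w‖ / (‖A‖ - ‖B‖) := ⟨_, rfl⟩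
  have hR0 : 0 ≤ R := by rw [hR]; positivity
  have hmem : (0 : ℝ) ∈ Set.Icc ((fun ρ : ℝ => ‖A‖ * ρ - ‖w - B * ρ‖) 0)
      ((fun ρ : ℝ => ‖A‖ * ρ - ‖w - B * ρ‖) R) := by
    constructor
    · simp
    · have h1 : ‖w - B * R‖ ≤ ‖w‖ + ‖B‖ * R := by
        refine (norm_sub_le _ _).trans ?_
        rw [norm_mul, Complex.norm_of_nonneg hR0]
      have h2 : R * (‖A‖ - ‖B‖) = ‖w‖ := by rw [hR]; field_simp
      simp only
      linarith
  obtain ⟨ρ, ⟨hρ0, -⟩, hρ⟩ := intermediate_value_Icc hR0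
    (f := fun ρ : ℝ => ‖A‖ * ρ - ‖w - B * ρ‖) (by fun_prop) hmem
  obtain ⟨z, hz⟩ := IsAlgClosed.exists_pow_nat_eq ((w - B * ρ) / A) (n := 2) (by norm_num)
  have hzρ : ‖z‖ ^ 2 = ρ := by
    rw [← norm_pow, hz, norm_div, div_eq_iff (norm_ne_zero_iff.mpr hA)]
    simp only at hρ
    linarith
  refine ⟨z, ?_⟩
  rw [← Complex.ofReal_pow, hzρ, hz]
  field_simp
  ring

lemma norm_one_add_I_mul_lt {η : ℂ} (hη : 0 < η.im) :
    ‖1 + Complex.I * η‖ < ‖1 - Complex.I * η‖ := by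
  rw [← sq_lt_sq₀ (norm_nonneg _) (norm_nonneg _), Complex.sq_norm, Complex.sq_norm,
    Complex.normSq_apply, Complex.normSq_apply]
  simp only [Complex.add_re, Complex.add_im, Complex.sub_re, Complex.sub_im, Complex.one_re,
    Complex.one_im, Complex.I_mul_re, Complex.I_mul_im]
  nlinarith

lemma exists_mul_add_I_mul_eq {α η : ℂ} (hα : α ≠ 0) (hη : 0 < η.im) (w : ℂ) :
    ∃ x ξ : ℝ, α * ((ξ : ℂ) + Complex.I * x) * ((ξ : ℂ) + η * x) = w := by
  have h : ‖(1 + Complex.I * η) / 2‖ < ‖(1 - Complex.I * η) / 2‖ := by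
    rw [norm_div, norm_div]
    exact div_lt_div_of_pos_right (norm_one_add_I_mul_lt hη) (by simp)
  obtain ⟨z, hz⟩ := exists_mul_sq_add_mul_norm_sq h (w / α)
  refine ⟨z.im, z.re, ?_⟩
  have hz' : (z.re : ℂ) + z.im * Complex.I = z := Complex.re_add_im z
  have hn : (‖z‖ : ℂ) ^ 2 = z.re ^ 2 + z.im ^ 2 := by
    rw [← Complex.ofReal_pow, Complex.sq_norm, Complex.normSq_apply]
    push_cast
    ring
  obtain ⟨a, ha⟩ : ∃ a, a = z.re := ⟨_, rfl⟩
  obtain ⟨b, hb⟩ : ∃ b, b = z.im := ⟨_, rfl⟩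
  rw [← ha, ← hb] at hn hz' ⊢
  rw [hn, ← hz', eq_div_iff hα] at hz
  rw [← hz]
  linear_combination (α * η * a * b - α / 2 * b ^ 2 + α * η * Complex.I / 2 * b ^ 2) *
    Complex.I_sq

lemma exists_mul_sub_I_mul_eq {α η : ℂ} (hα : α ≠ 0) (hη : η.im < 0) (w : ℂ) :
    ∃ x ξ : ℝ, α * ((ξ : ℂ) - Complex.I * x) * ((ξ : ℂ) + η * x) = w := by
  obtain ⟨x, ξ, h⟩ := exists_mul_add_I_mul_eq hα (η := -η) (by simpa using hη) w
  refine ⟨-x, ξ, ?_⟩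
  rw [← h]
  push_cast
  ring

lemma exists_linearMap_rotation (φ : ℝ) :
    ∃ χ : (ℝ × ℝ) →ₗ[ℝ] (ℝ × ℝ), LinearMap.det χ = 1 ∧ ∀ x ξ : ℝ,
      χ (x, ξ) = (Real.cos φ * x + Real.sin φ * ξ, -Real.sin φ * x + Real.cos φ * ξ) :=
  exists_linearMap_det_eq_one (by linear_combination Real.sin_sq_add_cos_sq φ)

/-- A form `|z|² + τz²` with `z = ξ + ix` and `|τ| < 1` is symplectically equivalent to a multiple
of `ξ² + e^{iθ}x²`. -/
lemma exists_linearMap_diagonalize {τ : ℂ} (hτ : ‖τ‖ < 1) :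
    ∃ χ : (ℝ × ℝ) →ₗ[ℝ] (ℝ × ℝ), LinearMap.det χ = 1 ∧
      ∃ β : ℂ, ∃ θ : ℝ, β ≠ 0 ∧ 0 ≤ θ ∧ θ < Real.pi ∧ ∀ x ξ : ℝ,
        ((χ (x, ξ)).2 : ℂ) ^ 2 + ((χ (x, ξ)).1 : ℂ) ^ 2 +
            τ * ((χ (x, ξ)).2 + Complex.I * (χ (x, ξ)).1) ^ 2 =
          β * ((ξ : ℂ) ^ 2 + Complex.exp (θ * Complex.I) * (x : ℂ) ^ 2) := by
  obtain ⟨t, ht⟩ : ∃ t, t = ‖τ‖ := ⟨_, rfl⟩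
  have ht0 : 0 ≤ t := ht ▸ norm_nonneg τ
  have ht1 : t < 1 := ht ▸ hτ
  obtain ⟨ψ, hψ⟩ : ∃ ψ, ψ = Real.arcsin t := ⟨_, rfl⟩
  have hψ0 : 0 ≤ ψ := hψ ▸ Real.arcsin_nonneg.mpr ht0
  have hψ1 : ψ < Real.pi / 2 := hψ ▸ Real.arcsin_lt_pi_div_two.mpr ht1
  have hsin : Real.sin ψ = t := by rw [hψ, Real.sin_arcsin (by linarith) ht1.le]
  obtain ⟨s, hs⟩ : ∃ s, s = Real.cos ψ := ⟨_, rfl⟩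
  have hs0 : 0 < s := hs ▸ Real.cos_pos_of_mem_Ioo ⟨by linarith, hψ1⟩
  have hst : s ^ 2 + t ^ 2 = 1 := by rw [hs, ← hsin]; exact Real.cos_sq_add_sin_sq ψ
  have hexp : Complex.exp (ψ * Complex.I) = s + t * Complex.I := by
    rw [Complex.exp_mul_I, ← Complex.ofReal_cos, ← Complex.ofReal_sin, hsin, hs]
  have hexp2 : Complex.exp ((2 * ψ : ℝ) * Complex.I) = (s + t * Complex.I) ^ 2 := by
    rw [← hexp, ← Complex.exp_nat_mul]
    congr 1
    push_cast
    ring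
  -- The rotation `χ₁` makes `τ` real, and `χ₂` rescales the axes to make the square coefficients
  -- equal and then turns by `π / 4` to remove the cross term.
  obtain ⟨φ, hφ⟩ : ∃ φ, φ = -(τ.arg / 2) := ⟨_, rfl⟩
  have hrot : τ * Complex.exp (φ * Complex.I) ^ 2 = t := by
    have h1 : τ = t * Complex.exp (τ.arg * Complex.I) := by
      rw [ht]
      exact (Complex.norm_mul_exp_arg_mul_I τ).symm
    have h2 : (τ.arg : ℂ) * Complex.I + (2 : ℕ) * (φ * Complex.I) = 0 := by
      rw [hφ]
      push_cast
      ring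
    rw [← Complex.exp_nat_mul]
    nth_rewrite 1 [h1]
    rw [mul_assoc, ← Complex.exp_add, h2, Complex.exp_zero, mul_one]
  obtain ⟨χ₁, hdet₁, hχ₁⟩ := exists_linearMap_rotation φ
  obtain ⟨κ, hκ⟩ : ∃ κ, κ = Real.sqrt (s / (1 + t)) := ⟨_, rfl⟩
  have hκ0 : 0 < κ := hκ ▸ Real.sqrt_pos.mpr (by positivity)
  have hκ2 : κ ^ 2 * (1 + t) = s := by
    rw [hκ, Real.sq_sqrt (by positivity)]
    field_simp
  have hκ3 : (κ⁻¹) ^ 2 * (1 - t) = s := by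
    rw [inv_pow, inv_mul_eq_iff_eq_mul₀ (by positivity)]
    refine mul_right_cancel₀ (b := 1 + t) (by positivity) ?_
    linear_combination -s * hκ2 - hst
  obtain ⟨c, hc⟩ : ∃ c : ℝ, c ^ 2 = 1 / 2 := ⟨Real.sqrt (1 / 2), Real.sq_sqrt (by norm_num)⟩
  have hκκ : κ * κ⁻¹ = 1 := mul_inv_cancel₀ hκ0.ne'
  obtain ⟨χ₂, hdet₂, hχ₂⟩ := exists_linearMap_det_eq_one
    (a := c * κ⁻¹) (b := -(c * κ⁻¹)) (c := c * κ) (d := c * κ)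
    (by linear_combination 2 * c ^ 2 * hκκ + 2 * hc)
  have hβ : ((s : ℂ) - t * Complex.I) * (s + t * Complex.I) = 1 := by
    have : (s : ℂ) ^ 2 + (t : ℂ) ^ 2 = 1 := by exact_mod_cast hst
    linear_combination this - (t : ℂ) ^ 2 * Complex.I_sq
  refine ⟨χ₁ ∘ₗ χ₂, by rw [LinearMap.det_comp, hdet₁, hdet₂, one_mul], s - t * Complex.I, 2 * ψ,
    left_ne_zero_of_mul_eq_one hβ, by linarith, by linarith, fun x ξ => ?_⟩
  have hdiag : ∀ x ξ : ℝ, ((χ₁ (x, ξ)).2 : ℂ) ^ 2 + ((χ₁ (x, ξ)).1 : ℂ) ^ 2 +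
      τ * ((χ₁ (x, ξ)).2 + Complex.I * (χ₁ (x, ξ)).1) ^ 2 =
        (1 + t) * (ξ : ℂ) ^ 2 + (1 - t) * (x : ℂ) ^ 2 + 2 * t * Complex.I * x * ξ := by
    intro x ξ
    have hz : ((χ₁ (x, ξ)).2 : ℂ) + Complex.I * (χ₁ (x, ξ)).1 =
        Complex.exp (φ * Complex.I) * (ξ + Complex.I * x) := by
      rw [hχ₁, Complex.exp_mul_I]
      push_cast
      linear_combination -Complex.sin φ * x * Complex.I_sq
    have hn : ((χ₁ (x, ξ)).2 : ℂ) ^ 2 + ((χ₁ (x, ξ)).1 : ℂ) ^ 2 = (ξ : ℂ) ^ 2 + (x : ℂ) ^ 2 := by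
      rw [hχ₁]
      push_cast
      linear_combination ((ξ : ℂ) ^ 2 + (x : ℂ) ^ 2) * Complex.sin_sq_add_cos_sq φ
    rw [hz, hn]
    linear_combination (ξ + Complex.I * x) ^ 2 * hrot + t * (x : ℂ) ^ 2 * Complex.I_sq
  rw [LinearMap.comp_apply, hχ₂, hdiag, hexp2]
  have hκ2' : (κ : ℂ) ^ 2 * (1 + t) = s := by exact_mod_cast hκ2
  have hκ3' : ((κ⁻¹ : ℝ) : ℂ) ^ 2 * (1 - t) = s := by exact_mod_cast hκ3
  have hκκ' : (κ : ℂ) * ((κ⁻¹ : ℝ) : ℂ) = 1 := by exact_mod_cast hκκ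
  have hc' : (c : ℂ) ^ 2 = 1 / 2 := by
    rw [← Complex.ofReal_pow, hc]
    simp
  generalize κ⁻¹ = ι at *
  push_cast
  linear_combination (c : ℂ) ^ 2 * (x + ξ) ^ 2 * hκ2' + (c : ℂ) ^ 2 * (x - ξ) ^ 2 * hκ3' +
    2 * t * Complex.I * (c : ℂ) ^ 2 * (x ^ 2 - ξ ^ 2) * hκκ' +
    (s * ((x + ξ) ^ 2 + (x - ξ) ^ 2) + 2 * t * Complex.I * (x ^ 2 - ξ ^ 2)) * hc' -
    (x : ℂ) ^ 2 * (s + t * Complex.I) * hβ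

/-- If the coefficients of the two factors have imaginary parts of opposite signs, the form is
symplectically equivalent to a multiple of `ξ² + e^{iθ}x²`. -/
lemma exists_linearMap_diagonalize_mul {l m : ℂ} (hl : 0 < l.im) (hm : m.im < 0) :
    ∃ χ : (ℝ × ℝ) →ₗ[ℝ] (ℝ × ℝ), LinearMap.det χ = 1 ∧
      ∃ β : ℂ, ∃ θ : ℝ, β ≠ 0 ∧ 0 ≤ θ ∧ θ < Real.pi ∧ ∀ x ξ : ℝ,
        (((χ (x, ξ)).2 : ℂ) + l * (χ (x, ξ)).1) * ((χ (x, ξ)).2 + m * (χ (x, ξ)).1) =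
          β * ((ξ : ℂ) ^ 2 + Complex.exp (θ * Complex.I) * (x : ℂ) ^ 2) := by
  have hκ : 0 < Real.sqrt l.im := Real.sqrt_pos.mpr hl
  obtain ⟨χ₁, hdet₁, η, hη, h₁⟩ := exists_linearMap_normalize_factor l m (ε := 1) hκ
    (by rw [Real.sq_sqrt hl.le, one_mul])
  replace hη : η.im < 0 := hη ▸ div_neg_of_neg_of_pos hm (by positivity)
  obtain ⟨B, hB⟩ : ∃ B, B = (1 + Complex.I * η) / 2 := ⟨_, rfl⟩
  obtain ⟨A, hA⟩ : ∃ A, A = (1 - Complex.I * η) / 2 := ⟨_, rfl⟩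
  have hAB : ‖A‖ < ‖B‖ := by
    have := norm_one_add_I_mul_lt (η := -η) (by simpa using hη)
    rw [hA, hB, norm_div, norm_div]
    refine div_lt_div_of_pos_right ?_ (by simp)
    simpa [← sub_eq_add_neg] using this
  have hB0 : B ≠ 0 := norm_pos_iff.mp ((norm_nonneg A).trans_lt hAB)
  obtain ⟨χ₂, hdet₂, β, θ, hβ, hθ0, hθ1, h₂⟩ := exists_linearMap_diagonalize (τ := A / B)
    (by rw [norm_div, div_lt_one (norm_pos_iff.mpr hB0)]; exact hAB)
  refine ⟨χ₁ ∘ₗ χ₂, by rw [LinearMap.det_comp, hdet₁, hdet₂, one_mul],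
    (Real.sqrt l.im : ℂ) ^ 2 * B * β, θ,
    mul_ne_zero (mul_ne_zero (pow_ne_zero 2 (by exact_mod_cast hκ.ne')) hB0) hβ,
    hθ0, hθ1, fun x ξ => ?_⟩
  rw [LinearMap.comp_apply, h₁ (χ₂ (x, ξ)).1 (χ₂ (x, ξ)).2, mul_assoc _ β, ← h₂]
  generalize χ₂ (x, ξ) = p
  have hs : ((p.2 : ℂ) + Complex.I * p.1) * (p.2 + η * p.1) =
      B * (p.2 ^ 2 + p.1 ^ 2) + A * (p.2 + Complex.I * p.1) ^ 2 := by
    rw [hA, hB]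
    linear_combination (η * p.2 * p.1 - (p.1 : ℂ) ^ 2 / 2 + η * Complex.I * (p.1 : ℂ) ^ 2 / 2) *
      Complex.I_sq
  have hdiv : B * (A / B) = A := mul_div_cancel₀ A hB0
  push_cast
  linear_combination (Real.sqrt l.im : ℂ) ^ 2 * hs -
    (Real.sqrt l.im : ℂ) ^ 2 * (p.2 + Complex.I * p.1) ^ 2 * hdiv

/-- every elliptic complex-valued quadratic form on
`ℝ_x × ℝ_ξ` can be brought, by a linear symplectic transformation `χ` of `ℝ²`
(a linear map of determinant `1`), to one of the three normal forms
`α(ξ² + e^{iθ}x²)` with `0 ≤ θ < π`, `α(ξ + ix)(ξ + ηx)` with `Im η > 0`, or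
`α(ξ − ix)(ξ + ηx)` with `Im η < 0`; and in the last two cases the numerical
range of `q` is all of `ℂ`. -/
theorem normal_forms_dimension_one
    (q : (ℝ × ℝ) → ℂ)
    (hq : IsCQuadForm q)
    (hell : ∀ X : ℝ × ℝ, q X = 0 → X = 0) :
    ∃ χ : (ℝ × ℝ) →ₗ[ℝ] (ℝ × ℝ), LinearMap.det χ = 1 ∧
      ((∃ α : ℂ, ∃ θ : ℝ, α ≠ 0 ∧ 0 ≤ θ ∧ θ < Real.pi ∧
          ∀ x ξ : ℝ, q (χ (x, ξ))
            = α * ((ξ : ℂ) ^ 2 + Complex.exp (θ * Complex.I) * (x : ℂ) ^ 2)) ∨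
       (∃ α η : ℂ, α ≠ 0 ∧ 0 < η.im ∧
          (∀ x ξ : ℝ, q (χ (x, ξ))
            = α * ((ξ : ℂ) + Complex.I * (x : ℂ)) * ((ξ : ℂ) + η * (x : ℂ))) ∧
          Set.range q = Set.univ) ∨
       (∃ α η : ℂ, α ≠ 0 ∧ η.im < 0 ∧
          (∀ x ξ : ℝ, q (χ (x, ξ))
            = α * ((ξ : ℂ) - Complex.I * (x : ℂ)) * ((ξ : ℂ) + η * (x : ℂ))) ∧
          Set.range q = Set.univ)) := by
  obtain ⟨a, l, m, ha, hl, hm, hfac⟩ := hq.exists_eq_mul hell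
  have hfac' : ∀ X : ℝ × ℝ, q X = a * (((X.2 : ℂ) + l * X.1) * ((X.2 : ℂ) + m * X.1)) :=
    fun X => (hfac X.1 X.2).trans (mul_assoc _ _ _)
  rcases hl.lt_or_gt with hl | hl <;> rcases hm.lt_or_gt with hm | hm
  · have hκ : 0 < Real.sqrt (-l.im) := Real.sqrt_pos.mpr (neg_pos.mpr hl)
    obtain ⟨χ, hdet, η, hη, h⟩ := exists_linearMap_normalize_factor l m (ε := -1) hκ
      (by rw [Real.sq_sqrt (neg_pos.mpr hl).le]; ring)
    replace hη : η.im < 0 := hη ▸ div_neg_of_neg_of_pos hm (by positivity)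
    have hα : a * (Real.sqrt (-l.im) : ℂ) ^ 2 ≠ 0 :=
      mul_ne_zero ha (pow_ne_zero 2 (by exact_mod_cast hκ.ne'))
    have hform : ∀ x ξ : ℝ, q (χ (x, ξ)) = a * (Real.sqrt (-l.im) : ℂ) ^ 2 *
        ((ξ : ℂ) - Complex.I * (x : ℂ)) * ((ξ : ℂ) + η * (x : ℂ)) := by
      intro x ξ
      rw [hfac', h]
      push_cast
      ring
    refine ⟨χ, hdet, Or.inr (Or.inr ⟨_, η, hα, hη, hform, Set.eq_univ_of_forall fun w => ?_⟩)⟩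
    obtain ⟨x, ξ, hw⟩ := exists_mul_sub_I_mul_eq hα hη w
    exact ⟨χ (x, ξ), (hform x ξ).trans hw⟩
  · obtain ⟨χ, hdet, β, θ, hβ, hθ0, hθ1, h⟩ := exists_linearMap_diagonalize_mul hm hl
    refine ⟨χ, hdet, Or.inl ⟨a * β, θ, mul_ne_zero ha hβ, hθ0, hθ1, fun x ξ => ?_⟩⟩
    rw [hfac', mul_comm (_ + l * _), h, mul_assoc]
  · obtain ⟨χ, hdet, β, θ, hβ, hθ0, hθ1, h⟩ := exists_linearMap_diagonalize_mul hl hm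
    refine ⟨χ, hdet, Or.inl ⟨a * β, θ, mul_ne_zero ha hβ, hθ0, hθ1, fun x ξ => ?_⟩⟩
    rw [hfac', h, mul_assoc]
  · have hκ : 0 < Real.sqrt l.im := Real.sqrt_pos.mpr hl
    obtain ⟨χ, hdet, η, hη, h⟩ := exists_linearMap_normalize_factor l m (ε := 1) hκ
      (by rw [Real.sq_sqrt hl.le, one_mul])
    replace hη : 0 < η.im := hη ▸ div_pos hm (by positivity)
    have hα : a * (Real.sqrt l.im : ℂ) ^ 2 ≠ 0 :=
      mul_ne_zero ha (pow_ne_zero 2 (by exact_mod_cast hκ.ne'))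
    have hform : ∀ x ξ : ℝ, q (χ (x, ξ)) = a * (Real.sqrt l.im : ℂ) ^ 2 *
        ((ξ : ℂ) + Complex.I * (x : ℂ)) * ((ξ : ℂ) + η * (x : ℂ)) := by
      intro x ξ
      rw [hfac', h]
      push_cast
      ring
    refine ⟨χ, hdet, Or.inr (Or.inl ⟨_, η, hα, hη, hform, Set.eq_univ_of_forall fun w => ?_⟩)⟩
    obtain ⟨x, ξ, hw⟩ := exists_mul_add_I_mul_eq hα hη w
    exact ⟨χ (x, ξ), (hform x ξ).trans hw⟩
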